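/- For every α with φ ≤ α ≤ 4, the two-dimensional Lebesgue measure of the set {(x,y) ∈ Ω_φ : x(φ̄x + y) > 1/α} equals φ̄ − (1/α)(1 + ln(φ̄α)). -/

import Mathlib

open Matrix MeasureTheory Filter Topology

noncomputable section

abbrev SL2 := Matrix.SpecialLinearGroup (Fin 2) ℝ

/-- The golden ratio φ = (1+√5)/2. -/
def phi : ℝ := (1 + Real.sqrt 5) / 2

/-- φ̄ = 1/φ. -/
def phib : ℝ := phi⁻¹

/-- S = [[0,−1],[1,0]]. -/
def Smat : SL2 := ⟨!![0, -1; 1, 0], by norm_num [Matrix.det_fin_two_of]⟩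

/-- P = [[1,φ],[0,1]]. -/
def Pmat : SL2 := ⟨!![1, phi; 0, 1], by norm_num [Matrix.det_fin_two_of]⟩

/-- The Veech group of the golden L: the subgroup generated by S and P. -/
def Γ : Subgroup SL2 := Subgroup.closure {Smat, Pmat}

/-- Linear action of a 2×2 matrix on ℝ². -/
def mact (g : Matrix (Fin 2) (Fin 2) ℝ) (v : ℝ × ℝ) : ℝ × ℝ :=
  (g 0 0 * v.1 + g 0 1 * v.2, g 1 0 * v.1 + g 1 1 * v.2)

/-- Λ = Γ·(1,0)ᵀ. -/
def Λ : Set (ℝ × ℝ) := {v | ∃ γ ∈ Γ, v = mact (γ : Matrix (Fin 2) (Fin 2) ℝ) (1, 0)}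

/-- g_{a,b} = [[a,b],[0,1/a]]. -/
def gab (a b : ℝ) : Matrix (Fin 2) (Fin 2) ℝ := !![a, b; 0, a⁻¹]

/-- h_s = [[1,0],[−s,1]]. -/
def hmat (s : ℝ) : Matrix (Fin 2) (Fin 2) ℝ := !![1, 0; -s, 1]

/-- Ω = {(a,b) : 0 < a ≤ 1, 1 − aφ < b ≤ 1}. -/
def Ω : Set (ℝ × ℝ) := {p | 0 < p.1 ∧ p.1 ≤ 1 ∧ 1 - p.1 * phi < p.2 ∧ p.2 ≤ 1}

/-- Ω₁ = {(a,b) ∈ Ω : φ̄ ≤ a ≤ 1, 1 − aφ < b ≤ φ̄ − a}. -/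
def Ω₁ : Set (ℝ × ℝ) :=
  {p | p ∈ Ω ∧ phib ≤ p.1 ∧ p.1 ≤ 1 ∧ 1 - p.1 * phi < p.2 ∧ p.2 ≤ phib - p.1}

/-- Ω_φ = {(a,b) ∈ Ω : φ̄² ≤ a ≤ 1, φ̄ − a < b ≤ φ̄ − aφ̄}. -/
def Ωphi : Set (ℝ × ℝ) :=
  {p | p ∈ Ω ∧ phib ^ 2 ≤ p.1 ∧ p.1 ≤ 1 ∧ phib - p.1 < p.2 ∧ p.2 ≤ phib - p.1 * phib}

/-- Ω_∞ = {(a,b) ∈ Ω : φ̄ − aφ̄ < b ≤ 1}. -/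
def Ωinf : Set (ℝ × ℝ) := {p | p ∈ Ω ∧ phib - p.1 * phib < p.2 ∧ p.2 ≤ 1}

-- The return time function R.
open Classical in
noncomputable def Rfun (p : ℝ × ℝ) : ℝ :=
  if p ∈ Ω₁ then 1 / (p.1 * (p.1 + p.2))
  else if p ∈ Ωphi then 1 / (p.1 * (p.1 * phib + p.2))
  else 1 / (p.1 * p.2)

/-- The probability measure m with dm = (2/φ) da db on Ω. -/
noncomputable def m : Measure (ℝ × ℝ) := ENNReal.ofReal (2 / phi) • volume.restrict Ω

-- The golden-L BCZ map T.
open Classical in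
noncomputable def Tmap (p : ℝ × ℝ) : ℝ × ℝ :=
  if p ∈ Ω₁ then
    ((p.1 + p.2) * phi,
      p.1 + p.2 * phi +
        (-(⌊(p.1 + p.2 * phi - 1) / (phi ^ 2 * (p.1 + p.2))⌋ : ℤ) : ℝ) * phi ^ 2 * (p.1 + p.2))
  else if p ∈ Ωphi then
    (p.1 + p.2 * phi,
      p.2 + (-(⌊(p.2 - 1) / (phi * (p.1 + p.2 * phi))⌋ : ℤ) : ℝ) * phi * (p.1 + p.2 * phi))
  else
    (p.2, -p.1 + (-(⌊(-p.1 - 1) / (phi * p.2)⌋ : ℤ) : ℝ) * phi * p.2)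

theorem phi_pos : 0 < phi := by
  unfold phi; positivity

theorem phib_pos : 0 < phib := inv_pos.mpr phi_pos

theorem phi_mul_phib : phi * phib = 1 := mul_inv_cancel₀ phi_pos.ne'

theorem phi_sq : phi ^ 2 = phi + 1 := by
  have h : Real.sqrt 5 ^ 2 = 5 := Real.sq_sqrt (by norm_num)
  unfold phi
  linear_combination h / 4

theorem phi_eq_phib_add_one : phi = phib + 1 := by
  linear_combination phib * phi_sq - (phi - 1) * phi_mul_phib

theorem phib_sq : phib ^ 2 = 1 - phib := by
  linear_combination phi_mul_phib - phib * phi_eq_phib_add_one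

theorem phib_sq_le_phi_div_four : phib ^ 2 ≤ phi / 4 := by
  nlinarith [phib_sq, phi_eq_phib_add_one, phib_pos]

/-- For `α ≤ 4`, the superlevel set avoids the lower edges of `Ωphi`, so only the hyperbola
and the top edge bound it. -/
theorem setOf_mem_Ωphi_and_lt_eq {α : ℝ} (hα : phi ≤ α) (hα4 : α ≤ 4) :
    {p : ℝ × ℝ | p ∈ Ωphi ∧ 1 / α < p.1 * (phib * p.1 + p.2)} =
      {p | p.1 ∈ Set.Ioc (phi / α) 1 ∧
        p.2 ∈ Set.Ioc (1 / α * p.1⁻¹ - phib * p.1) (phib - phib * p.1)} := by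
  have hα0 : 0 < α := phi_pos.trans_le hα
  have ht := phib_pos
  have hquarter : 1 / 4 ≤ 1 / α := one_div_le_one_div_of_le hα0 hα4
  have hlower {x : ℝ} (hx : 0 < x) (y : ℝ) :
      1 / α * x⁻¹ - phib * x < y ↔ 1 / α < x * (phib * x + y) := by
    rw [sub_lt_iff_lt_add', ← div_eq_mul_inv, div_lt_iff₀' hx]
  ext ⟨x, y⟩
  simp only [Ωphi, Ω, Set.mem_ofPred_eq, Set.mem_Ioc]
  constructor
  · rintro ⟨⟨⟨hx, hx1, -, -⟩, -, -, -, hy⟩, h⟩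
    refine ⟨⟨?_, hx1⟩, (hlower hx y).mpr h, by linarith⟩
    have h1 : 1 / α < x * phib := h.trans_le (by nlinarith)
    have h2 := mul_lt_mul_of_pos_left h1 phi_pos
    calc phi / α = phi * (1 / α) := by ring
      _ < phi * (x * phib) := h2
      _ = x := by linear_combination x * phi_mul_phib
  · rintro ⟨⟨hx, hx1⟩, hy1, hy2⟩
    have hxlow : phib ^ 2 ≤ x := by
      have : phi / 4 ≤ phi / α := div_le_div_of_nonneg_left phi_pos.le hα0 hα4
      linarith [phib_sq_le_phi_div_four]
    have hx0 : 0 < x := (div_pos phi_pos hα0).trans hx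
    have h := (hlower hx0 y).mp hy1
    refine ⟨⟨⟨hx0, hx1, ?_, ?_⟩, hxlow, hx1, ?_, by linarith⟩, h⟩
    · refine lt_of_mul_lt_mul_left (a := x) ?_ hx0.le
      nlinarith [sq_nonneg (x - 1 / 2), phi_eq_phib_add_one]
    · nlinarith [phib_sq]
    · refine lt_of_mul_lt_mul_left (a := x) ?_ hx0.le
      have hsq : (phib * x) ^ 2 = (1 - phib) * x ^ 2 := by rw [mul_pow, phib_sq]
      nlinarith [sq_nonneg (phib * x - 1 / 2)]

theorem volume_setOf_mem_Ioc_eq_lintegral {s : Set ℝ} {f g : ℝ → ℝ} (hf : Measurable f)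
    (hg : Measurable g) (hs : MeasurableSet s) :
    volume {p : ℝ × ℝ | p.1 ∈ s ∧ p.2 ∈ Set.Ioc (f p.1) (g p.1)} =
      ∫⁻ x in s, ENNReal.ofReal (g x - f x) := by
  rw [Measure.volume_eq_prod, Measure.prod_apply
    (measurableSet_region_between_oc hf hg hs), ← lintegral_indicator hs]
  refine lintegral_congr fun x ↦ ?_
  by_cases hx : x ∈ s
  · have : Prod.mk x ⁻¹' {p : ℝ × ℝ | p.1 ∈ s ∧ p.2 ∈ Set.Ioc (f p.1) (g p.1)} =
        Set.Ioc (f x) (g x) := by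
      ext y; simp [hx]
    rw [this, Real.volume_Ioc, Set.indicator_of_mem hx]
  · simp [hx]

theorem integral_const_sub_mul_inv {a b : ℝ} (ha : 0 < a) (hb : 0 < b) (c d : ℝ) :
    ∫ x in a..b, (c - d * x⁻¹) = (b - a) * c - d * Real.log (b / a) := by
  have hint : IntervalIntegrable (fun x : ℝ ↦ x⁻¹) volume a b :=
    intervalIntegral.intervalIntegrable_inv
      (fun x hx ↦ ((lt_min ha hb).trans_le hx.1).ne') continuousOn_id
  rw [intervalIntegral.integral_sub intervalIntegrable_const (hint.const_mul d),
    intervalIntegral.integral_const, intervalIntegral.integral_const_mul,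
    integral_inv_of_pos ha hb, smul_eq_mul]

/-- For φ ≤ α ≤ 4, the area of {(x,y) ∈ Ω_φ : x(φ̄x+y) > 1/α} equals
φ̄ − (1/α)(1 + ln(φ̄α)). -/
theorem F_phi_second_piece :
    ∀ α : ℝ, phi ≤ α → α ≤ 4 →
      (volume {p : ℝ × ℝ | p ∈ Ωphi ∧ 1 / α < p.1 * (phib * p.1 + p.2)}).toReal
        = phib - (1 / α) * (1 + Real.log (phib * α)) := by
  intro α hα hα4
  have hα0 : 0 < α := phi_pos.trans_le hα
  have ha : 0 < phi / α := div_pos phi_pos hα0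
  have hpos : ∀ x ∈ Set.Ioc (phi / α) 1, 0 ≤ phib - 1 / α * x⁻¹ := by
    intro x hx
    have hx0 : 0 < x := ha.trans hx.1
    rw [sub_nonneg, ← div_eq_mul_inv, div_le_iff₀ hx0]
    calc 1 / α = phib * (phi / α) := by linear_combination -(1 / α) * phi_mul_phib
      _ ≤ phib * x := by gcongr; exacts [phib_pos.le, hx.1.le]
  rw [setOf_mem_Ωphi_and_lt_eq hα hα4, volume_setOf_mem_Ioc_eq_lintegral
    (f := fun x ↦ 1 / α * x⁻¹ - phib * x) (g := fun x ↦ phib - phib * x)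
    (by fun_prop) (by fun_prop) measurableSet_Ioc]
  simp only [sub_sub_sub_cancel_right]
  rw [← integral_eq_lintegral_of_nonneg_ae
      ((ae_restrict_mem measurableSet_Ioc).mono hpos) (by fun_prop),
    ← intervalIntegral.integral_of_le ((div_le_one hα0).mpr hα),
    integral_const_sub_mul_inv ha one_pos, one_div_div, phib, div_eq_inv_mul α phi]
  field_simp [phi_pos.ne']
  ring
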